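/- A continuous function f : [−1,1] × [−1,1] → ℝ which is positive definite on S¹ × S¹, written in its expansion f(cos φ, cos ψ) = Σ_{m,k∈ℤ₊} a_{m,k} cos(mφ) cos(kψ) with all a_{m,k} ≥ 0 and Σ a_{m,k} < ∞, is strictly positive definite on S¹ × S¹ if, and only if, the set {(m,k) ∈ ℤ² : a_{|m|,|k|} > 0} intersects every product of full arithmetic progressions in ℤ, i.e. it meets (Nℤ+x) × (Mℤ+y) for every positive integers N, M, x, y. -/

import Mathlib

open scoped ComplexOrder

noncomputable section

/-- A kernel `K` on a type `α` is positive definite. -/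
def IsPDKernelT {α : Type*} (K : α → α → ℂ) : Prop :=
  ∀ (L : ℕ) (x : Fin L → α), Function.Injective x →
    ∀ c : Fin L → ℂ, 0 ≤ ∑ μ, ∑ ν, c μ * (starRingEnd ℂ) (c ν) * K (x μ) (x ν)

/-- A kernel `K` on a type `α` is strictly positive definite. -/
def IsSPDKernelT {α : Type*} (K : α → α → ℂ) : Prop :=
  IsPDKernelT K ∧
    ∀ (L : ℕ) (x : Fin L → α), Function.Injective x →
      ∀ c : Fin L → ℂ,
        ∑ μ, ∑ ν, c μ * (starRingEnd ℂ) (c ν) * K (x μ) (x ν) = 0 → c = 0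

/-- The unit circle `S¹ ⊆ ℝ²`. -/
abbrev SphereR2 : Type := ↥(Metric.sphere (0 : EuclideanSpace ℝ (Fin 2)) 1)

/-- `A ⊆ ℤ²` intersects every product of full arithmetic progressions in ℤ. -/
def MeetsAllProgressions (A : Set (ℤ × ℤ)) : Prop :=
  ∀ N M x y : ℤ, 0 < N → 0 < M → 0 < x → 0 < y →
    ∃ v ∈ A, (∃ j : ℤ, v.1 = N * j + x) ∧ (∃ j : ℤ, v.2 = M * j + y)


lemma jac_int : IsJacobsonRing ℤ := by
  rw [isJacobsonRing_iff_prime_eq]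
  intro P hP
  by_cases h : P = ⊥
  · subst h
    rw [eq_bot_iff]
    intro x hx
    rw [Ideal.mem_jacobson_bot] at hx
    have := Int.isUnit_iff.1 (hx x)
    rw [Ideal.mem_bot]
    rcases this with h | h
    · simpa using h
    · nlinarith [mul_self_nonneg x]
  · have := hP.isMaximal h
    exact Ideal.jacobson_eq_self_of_isMaximal

lemma finite_field_of_ft (K : Type) [Field K] [Algebra.FiniteType ℤ K] : Finite K := by
  have := jac_int
  have hfin : Module.Finite ℤ K := finite_of_finite_type_of_isJacobsonRing ℤ K
  obtain ⟨p, hp⟩ := CharP.exists K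
  rcases Nat.eq_zero_or_pos p with h0 | h0
  · subst h0
    have : CharZero K := CharP.charP_to_charZero K
    exact absurd (isField_of_isIntegral_of_isField (R := ℤ) (S := K)
      (RingHom.injective_int _) (Field.toIsField K)) Int.not_isField
  · have : AddGroup.FG K := by
      exact AddGroup.fg_iff_addMonoid_fg.2 (Module.Finite.iff_addGroup_fg.1 hfin |> AddGroup.fg_iff_addMonoid_fg.1)
    refine AddCommGroup.finite_of_fg_isAddTorsion K ?_
    intro x
    rw [isOfFinAddOrder_iff_nsmul_eq_zero]
    exact ⟨p, h0, by simp⟩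

lemma ft_quot (A K : Type) [CommRing A] [Field K] [Algebra ℤ A] [Algebra.FiniteType ℤ A]
    (g : A →+* K) (hg : Function.Surjective g) : Finite K := by
  let g' : A →ₐ[ℤ] K := { g with commutes' := by intro r; simp }
  have : Algebra.FiniteType ℤ K := Algebra.FiniteType.of_surjective g' hg
  exact finite_field_of_ft K

lemma key_ft (S : Set ℂ) (hS : S.Finite) (d : ℂ) (hd : d ≠ 0) :
    ∃ (R : Subalgebra ℤ ℂ) (K : Type) (_ : Field K) (_ : Finite K) (g : R →+* K)
      (hdR : d ∈ R), S ⊆ R ∧ g ⟨d, hdR⟩ ≠ 0 := by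
  let R := Algebra.adjoin ℤ (S ∪ {d, d⁻¹})
  have hft : Algebra.FiniteType ℤ R := Algebra.FiniteType.adjoin_of_finite (hS.union (by simp))
  have h1 : d ∈ R := Algebra.subset_adjoin (by simp)
  have h2 : d⁻¹ ∈ R := Algebra.subset_adjoin (by simp)
  obtain ⟨m, hm⟩ := Ideal.exists_maximal R
  let fld : Field (R ⧸ m) := Ideal.Quotient.field m
  refine ⟨R, R ⧸ m, fld,
    ft_quot R (R ⧸ m) (Ideal.Quotient.mk m) Ideal.Quotient.mk_surjective, Ideal.Quotient.mk m, h1,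
    fun s hs => Algebra.subset_adjoin (Or.inl hs), ?_⟩
  have hu : IsUnit (⟨d, h1⟩ : R) := by
    refine IsUnit.of_mul_eq_one ⟨d⁻¹, h2⟩ ?_
    ext
    simp [hd]
  exact (hu.map (Ideal.Quotient.mk m)).ne_zero

lemma exists_ne_char (L : ℕ) (z w : Fin L → ℂ) (hz : ∀ i, z i ≠ 0) (hw : ∀ i, w i ≠ 0)
    (hinj : Function.Injective fun i => (z i, w i)) (c : Fin L → ℂ) (hc : c ≠ 0) :
    ∃ n k : ℤ, ∑ i, c i * (z i ^ n * w i ^ k) ≠ 0 := by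
  by_contra! h
  let χ : Fin L → (Multiplicative (ℤ × ℤ) →* ℂ) := fun i =>
    { toFun := fun v => z i ^ v.toAdd.1 * w i ^ v.toAdd.2
      map_one' := by simp
      map_mul' := by
        intro a b
        simp only [toAdd_mul, Prod.fst_add, Prod.snd_add, zpow_add₀ (hz i), zpow_add₀ (hw i)]
        ring }
  have hχ : Function.Injective χ := by
    intro i j hij
    apply hinj
    have h1 := DFunLike.congr_fun hij (Multiplicative.ofAdd ((1, 0) : ℤ × ℤ))
    have h2 := DFunLike.congr_fun hij (Multiplicative.ofAdd ((0, 1) : ℤ × ℤ))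
    simp [χ] at h1 h2
    simp [h1, h2]
  have hli := (linearIndependent_monoidHom (Multiplicative (ℤ × ℤ)) ℂ).comp χ hχ
  rw [Fintype.linearIndependent_iff] at hli
  apply hc
  funext i
  refine hli c ?_ i
  funext v
  simpa [χ, Finset.sum_apply] using h v.toAdd.1 v.toAdd.2

lemma exists_prog (L : ℕ) (z w : Fin L → ℂ) (hz : ∀ i, z i ≠ 0) (hw : ∀ i, w i ≠ 0)
    (hinj : Function.Injective fun i => (z i, w i)) (c : Fin L → ℂ) (hc : c ≠ 0) :
    ∃ N n k : ℤ, 0 < N ∧ ∀ p q : ℤ,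
      ∑ i, c i * (z i ^ (N * p + n) * w i ^ (N * q + k)) ≠ 0 := by
  obtain ⟨n, k, hnk⟩ := exists_ne_char L z w hz hw hinj c hc
  obtain ⟨R, K, _, _, g, hdR, hS, hg⟩ := key_ft
    (Set.range z ∪ Set.range w ∪ Set.range c ∪ Set.range (fun i => (z i)⁻¹) ∪
      Set.range (fun i => (w i)⁻¹))
    (((((Set.finite_range z).union (Set.finite_range w)).union (Set.finite_range c)).union
      (Set.finite_range _)).union (Set.finite_range _)) _ hnk
  have mz : ∀ i, z i ∈ R := fun i => hS (by simp)
  have mw : ∀ i, w i ∈ R := fun i => hS (by simp)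
  have mc : ∀ i, c i ∈ R := fun i => hS (by simp)
  have mz' : ∀ i, (z i)⁻¹ ∈ R := fun i => hS (by simp)
  have mw' : ∀ i, (w i)⁻¹ ∈ R := fun i => hS (by simp)
  let Z : Fin L → Rˣ := fun i => ⟨⟨z i, mz i⟩, ⟨_, mz' i⟩, by ext; simp [hz i], by ext; simp [hz i]⟩
  let W : Fin L → Rˣ := fun i => ⟨⟨w i, mw i⟩, ⟨_, mw' i⟩, by ext; simp [hw i], by ext; simp [hw i]⟩
  have hZ : ∀ i (m : ℤ), (((Z i ^ m : Rˣ) : R) : ℂ) = z i ^ m := by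
    intro i m
    change (Units.map (R.val : R →* ℂ) (Z i ^ m)).val = _
    rw [map_zpow, Units.val_zpow_eq_zpow_val]
    rfl
  have hW : ∀ i (m : ℤ), (((W i ^ m : Rˣ) : R) : ℂ) = w i ^ m := by
    intro i m
    change (Units.map (R.val : R →* ℂ) (W i ^ m)).val = _
    rw [map_zpow, Units.val_zpow_eq_zpow_val]
    rfl
  let T : ℤ → ℤ → R := fun n k => ∑ i, (⟨c i, mc i⟩ : R) * ((Z i ^ n : Rˣ) * (W i ^ k : Rˣ))
  have hT : ∀ n k, ((T n k : R) : ℂ) = ∑ i, c i * (z i ^ n * w i ^ k) := by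
    intro n k
    simp [T, hZ, hW]
  have hcard : 0 < Nat.card Kˣ := Nat.card_pos
  refine ⟨Nat.card Kˣ, n, k, by exact_mod_cast hcard, ?_⟩
  intro p q h0
  apply hg
  have e1 : (⟨_, hdR⟩ : R) = T n k := by
    ext; rw [hT]
  have e2 : T (Nat.card Kˣ * p + n) (Nat.card Kˣ * q + k) = 0 := by
    ext; rw [hT, h0]; simp
  rw [e1, ← map_zero g, ← e2]
  have hU : ∀ (u : Rˣ) (p n : ℤ), g ((u ^ (Nat.card Kˣ * p + n) : Rˣ) : R) = g ((u ^ n : Rˣ) : R) := by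
    intro u p n
    have : Units.map (g : R →* K) (u ^ (Nat.card Kˣ * p + n)) = Units.map (g : R →* K) (u ^ n) := by
      rw [map_zpow, map_zpow, zpow_add, zpow_mul, zpow_natCast, pow_card_eq_one', one_zpow, one_mul]
    exact congrArg Units.val this
  simp only [T, map_sum, map_mul, hU]

/-- point on the circle -/
def pt (φ : ℝ) : SphereR2 := ⟨!₂[Real.cos φ, Real.sin φ], by
  simp [EuclideanSpace.norm_eq]⟩

lemma pt_inner (φ ψ : ℝ) : @inner ℝ _ _ (pt φ).1 (pt ψ).1 = Real.cos (φ - ψ) := by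
  simp [pt, PiLp.inner_apply, Fin.sum_univ_two, Real.cos_sub]
  ring

lemma pt_surj (u : SphereR2) : ∃ φ, pt φ = u := by
  obtain ⟨u, hu⟩ := u
  have h : u 0 ^ 2 + u 1 ^ 2 = 1 := by
    simpa [EuclideanSpace.norm_eq, Fin.sum_univ_two] using hu
  have hn : ‖(⟨u 0, u 1⟩ : ℂ)‖ = 1 := by
    rw [Complex.norm_def, Complex.normSq_apply, Real.sqrt_eq_one]
    linarith
  refine ⟨Complex.arg ⟨u 0, u 1⟩, Subtype.ext ?_⟩
  have h0 : (⟨u 0, u 1⟩ : ℂ) ≠ 0 := by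
    intro h0; rw [h0] at hn; simp at hn
  ext i
  fin_cases i
  · simp [pt, Complex.cos_arg h0, hn]
  · simp [pt, Complex.sin_arg, hn]

lemma pt_eq_iff (φ ψ : ℝ) : pt φ = pt ψ ↔
    Complex.exp (φ * Complex.I) = Complex.exp (ψ * Complex.I) := by
  constructor
  · intro h
    have h' := congrArg Subtype.val h
    have h0 := congrArg (fun v : EuclideanSpace ℝ (Fin 2) => v 0) h'
    have h1 := congrArg (fun v : EuclideanSpace ℝ (Fin 2) => v 1) h'
    simp [pt] at h0 h1
    apply Complex.ext
    · simpa [Complex.exp_ofReal_mul_I_re] using h0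
    · simpa [Complex.exp_ofReal_mul_I_im] using h1
  · intro h
    have h0 := congrArg Complex.re h
    have h1 := congrArg Complex.im h
    rw [Complex.exp_ofReal_mul_I_re, Complex.exp_ofReal_mul_I_re] at h0
    rw [Complex.exp_ofReal_mul_I_im, Complex.exp_ofReal_mul_I_im] at h1
    apply Subtype.ext
    simp [pt, h0, h1]

lemma cos_arccos_cos (m : ℕ) (φ : ℝ) :
    Real.cos (m * Real.arccos (Real.cos φ)) = Real.cos (m * φ) := by
  have h1 := Polynomial.Chebyshev.T_real_cos (Real.arccos (Real.cos φ)) m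
  have h2 := Polynomial.Chebyshev.T_real_cos φ m
  rw [Real.cos_arccos (Real.neg_one_le_cos _) (Real.cos_le_one _), h2] at h1
  simpa using h1.symm

/-- exponential sum -/
def FF {L : ℕ} (φ ψ : Fin L → ℝ) (c : Fin L → ℂ) (m k : ℤ) : ℂ :=
  ∑ i, c i * (Complex.exp (φ i * Complex.I) ^ m * Complex.exp (ψ i * Complex.I) ^ k)

lemma FF_sq {L : ℕ} (φ ψ : Fin L → ℝ) (c : Fin L → ℂ) (m k : ℤ) :
    ((Complex.normSq (FF φ ψ c m k) : ℝ) : ℂ) = ∑ i, ∑ j, c i * (starRingEnd ℂ) (c j) *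
      (Complex.exp ((m * (φ i - φ j)) * Complex.I) *
        Complex.exp ((k * (ψ i - ψ j)) * Complex.I)) := by
  rw [← Complex.mul_conj, FF, map_sum, Finset.sum_mul_sum]
  refine Finset.sum_congr rfl fun i _ => Finset.sum_congr rfl fun j _ => ?_
  simp only [map_mul, map_zpow₀, ← Complex.exp_conj, ← Complex.exp_int_mul, Complex.conj_I,
    Complex.conj_ofReal, map_intCast]
  have e1 : (m * (φ i - φ j) : ℂ) * Complex.I = m * (φ i * Complex.I) + m * (φ j * -Complex.I) := by
    ring
  have e2 : (k * (ψ i - ψ j) : ℂ) * Complex.I = k * (ψ i * Complex.I) + k * (ψ j * -Complex.I) := by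
    ring
  rw [e1, e2, Complex.exp_add, Complex.exp_add]
  ring

/-- symmetrised square sum -/
def HH {L : ℕ} (φ ψ : Fin L → ℝ) (c : Fin L → ℂ) (m k : ℕ) : ℝ :=
  (Complex.normSq (FF φ ψ c m k) + Complex.normSq (FF φ ψ c (-m) k) +
    Complex.normSq (FF φ ψ c m (-k)) + Complex.normSq (FF φ ψ c (-m) (-k))) / 4

lemma HH_eq {L : ℕ} (φ ψ : Fin L → ℝ) (c : Fin L → ℂ) (m k : ℕ) :
    ((HH φ ψ c m k : ℝ) : ℂ) = ∑ i, ∑ j, c i * (starRingEnd ℂ) (c j) *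
      ((Real.cos (m * (φ i - φ j)) * Real.cos (k * (ψ i - ψ j)) : ℝ) : ℂ) := by
  simp only [HH, Complex.ofReal_div, Complex.ofReal_add, FF_sq, ← Finset.sum_add_distrib,
    Complex.ofReal_ofNat, Finset.sum_div]
  refine Finset.sum_congr rfl fun i _ => Finset.sum_congr rfl fun j _ => ?_
  push_cast
  simp only [Complex.cos, neg_mul]
  ring

lemma HH_nonneg {L : ℕ} (φ ψ : Fin L → ℝ) (c : Fin L → ℂ) (m k : ℕ) : 0 ≤ HH φ ψ c m k := by
  unfold HH
  have := Complex.normSq_nonneg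
  have := this (FF φ ψ c m k)
  have := Complex.normSq_nonneg (FF φ ψ c (-m) k)
  have := Complex.normSq_nonneg (FF φ ψ c m (-k))
  have := Complex.normSq_nonneg (FF φ ψ c (-m) (-k))
  positivity

lemma HH_zero_iff {L : ℕ} (φ ψ : Fin L → ℝ) (c : Fin L → ℂ) (m k : ℕ) : HH φ ψ c m k = 0 ↔
    ∀ p q : ℤ, p.natAbs = m → q.natAbs = k → FF φ ψ c p q = 0 := by
  have h1 := Complex.normSq_nonneg (FF φ ψ c m k)
  have h2 := Complex.normSq_nonneg (FF φ ψ c (-m) k)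
  have h3 := Complex.normSq_nonneg (FF φ ψ c m (-k))
  have h4 := Complex.normSq_nonneg (FF φ ψ c (-m) (-k))
  constructor
  · intro h p q hp hq
    unfold HH at h
    rw [← Complex.normSq_eq_zero]
    rcases Int.natAbs_eq p with e | e <;> rcases Int.natAbs_eq q with e' | e' <;>
      rw [e, e', hp, hq] <;> linarith
  · intro h
    unfold HH
    simp [h m k, h (-m) k, h m (-k), h (-m) (-k)]

lemma sum_zero_iff (f : ℝ → ℝ → ℝ)
    (a : ℕ × ℕ → ℝ) (ha0 : ∀ i, 0 ≤ a i) (haS : Summable a)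
    (hexp : ∀ φ ∈ Set.Icc (0 : ℝ) Real.pi, ∀ ψ ∈ Set.Icc (0 : ℝ) Real.pi,
      f (Real.cos φ) (Real.cos ψ) =
        ∑' i : ℕ × ℕ, a i * Real.cos (i.1 * φ) * Real.cos (i.2 * ψ))
    {L : ℕ} (φ ψ : Fin L → ℝ) (c : Fin L → ℂ) :
    ∑ i, ∑ j, c i * (starRingEnd ℂ) (c j) *
      ((f (Real.cos (φ i - φ j)) (Real.cos (ψ i - ψ j)) : ℝ) : ℂ) = 0 ↔
    ∀ p q : ℤ, 0 < a (p.natAbs, q.natAbs) → FF φ ψ c p q = 0 := by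
  have hf : ∀ s t : ℝ, HasSum (fun i : ℕ × ℕ => a i * (Real.cos (i.1 * s) * Real.cos (i.2 * t)))
      (f (Real.cos s) (Real.cos t)) := by
    intro s t
    have h := hexp (Real.arccos (Real.cos s)) ⟨Real.arccos_nonneg _, Real.arccos_le_pi _⟩
      (Real.arccos (Real.cos t)) ⟨Real.arccos_nonneg _, Real.arccos_le_pi _⟩
    simp only [cos_arccos_cos,
      Real.cos_arccos (Real.neg_one_le_cos _) (Real.cos_le_one _), mul_assoc] at h
    rw [h]
    refine Summable.hasSum (Summable.of_norm_bounded haS fun i => ?_)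
    rw [Real.norm_eq_abs, abs_mul, abs_mul, abs_of_nonneg (ha0 i)]
    exact mul_le_of_le_one_right (ha0 i)
      (mul_le_one₀ (Real.abs_cos_le_one _) (abs_nonneg _) (Real.abs_cos_le_one _))
  have hS : HasSum (fun v : ℕ × ℕ => ((a v * HH φ ψ c v.1 v.2 : ℝ) : ℂ))
      (∑ i, ∑ j, c i * (starRingEnd ℂ) (c j) *
      ((f (Real.cos (φ i - φ j)) (Real.cos (ψ i - ψ j)) : ℝ) : ℂ)) := by
    have : HasSum (fun v : ℕ × ℕ => ∑ i, ∑ j, c i * (starRingEnd ℂ) (c j) *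
      ((a v * (Real.cos (v.1 * (φ i - φ j)) * Real.cos (v.2 * (ψ i - ψ j))) : ℝ) : ℂ))
      (∑ i, ∑ j, c i * (starRingEnd ℂ) (c j) *
      ((f (Real.cos (φ i - φ j)) (Real.cos (ψ i - ψ j)) : ℝ) : ℂ)) :=
      hasSum_sum fun i _ => hasSum_sum fun j _ =>
        (Complex.hasSum_ofReal.2 (hf _ _)).mul_left _
    convert this using 2 with v
    rw [Complex.ofReal_mul, HH_eq, Finset.mul_sum]
    refine Finset.sum_congr rfl fun i _ => ?_
    rw [Finset.mul_sum]
    refine Finset.sum_congr rfl fun j _ => ?_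
    push_cast
    ring
  have hnn : ∀ v : ℕ × ℕ, 0 ≤ a v * HH φ ψ c v.1 v.2 :=
    fun v => mul_nonneg (ha0 v) (HH_nonneg _ _ _ _ _)
  constructor
  · intro h p q hpq
    rw [h] at hS
    have h0 : HasSum (fun v : ℕ × ℕ => a v * HH φ ψ c v.1 v.2) 0 := by
      rw [← Complex.hasSum_ofReal]; simpa using hS
    rw [hasSum_zero_iff_of_nonneg hnn] at h0
    have h1 := congrFun h0 (p.natAbs, q.natAbs)
    simp only [Pi.zero_apply, mul_eq_zero] at h1
    exact (HH_zero_iff _ _ _ _ _).1 (h1.resolve_left hpq.ne') p q rfl rfl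
  · intro h
    refine hS.unique ?_
    convert hasSum_zero with v
    rcases (ha0 v).eq_or_lt with e | e
    · simp [← e]
    · have := (HH_zero_iff φ ψ c v.1 v.2).2 (by
        rintro p q hp hq
        exact h p q (by rw [hp, hq]; exact e))
      simp [this]

lemma root_sum (N : ℕ) (hN : 0 < N) (t : ℤ) (ht : ¬ (N : ℤ) ∣ t) :
    ∑ j : Fin N, Complex.exp ((2 * Real.pi * j / N : ℝ) * Complex.I) ^ t = 0 := by
  have hprim := Complex.isPrimitiveRoot_exp N hN.ne'
  set ζ := Complex.exp (2 * Real.pi * Complex.I / N) with hζ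
  have h1 : ζ ^ t ≠ 1 := fun h => ht ((hprim.zpow_eq_one_iff_dvd t).1 h)
  have h2 : (ζ ^ t) ^ N = 1 := by
    rw [← zpow_natCast, ← zpow_mul, mul_comm, zpow_mul, zpow_natCast, hprim.pow_eq_one, one_zpow]
  have h3 : ∀ j : Fin N, Complex.exp ((2 * Real.pi * j / N : ℝ) * Complex.I) ^ t
      = (ζ ^ t) ^ (j : ℕ) := by
    intro j
    rw [← zpow_natCast, ← zpow_mul, mul_comm t, zpow_mul, zpow_natCast, hζ, ← Complex.exp_nat_mul]
    congr 2
    push_cast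
    ring
  rw [Finset.sum_congr rfl fun j _ => h3 j, Fin.sum_univ_eq_sum_range (fun j => (ζ ^ t) ^ j),
    geom_sum_eq h1, h2]
  simp

lemma root_inj (N : ℕ) (i j : Fin N)
    (h : Complex.exp ((2 * Real.pi * i / N : ℝ) * Complex.I) =
      Complex.exp ((2 * Real.pi * j / N : ℝ) * Complex.I)) : i = j := by
  have hN : N ≠ 0 := by have := i.2; omega
  have hprim := Complex.isPrimitiveRoot_exp N hN
  apply Fin.ext
  refine hprim.pow_inj i.2 j.2 ?_
  rw [← Complex.exp_nat_mul, ← Complex.exp_nat_mul]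
  convert h using 2 <;> push_cast <;> ring

/-- Section 6, characterization of SPD functions on `S¹ × S¹`, from
[P-jean-menS1xS1]: a continuous PD function on `S¹ × S¹` with expansion
`f(cos φ, cos ψ) = Σ a_{m,k} cos(mφ) cos(kψ)` is SPD iff
`{(m,k) ∈ ℤ² : a_{|m|,|k|} > 0}` intersects every product of full arithmetic
progressions in ℤ. -/
theorem stmt19 (f : ℝ → ℝ → ℝ)
    (hf : ContinuousOn (fun v : ℝ × ℝ => f v.1 v.2)
      (Set.Icc (-1 : ℝ) 1 ×ˢ Set.Icc (-1 : ℝ) 1))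
    (hPD : IsPDKernelT (fun u v : SphereR2 × SphereR2 =>
      ((f (@inner ℝ _ _ u.1.1 v.1.1) (@inner ℝ _ _ u.2.1 v.2.1) : ℝ) : ℂ)))
    (a : ℕ × ℕ → ℝ) (ha0 : ∀ i, 0 ≤ a i) (haS : Summable a)
    (hexp : ∀ φ ∈ Set.Icc (0 : ℝ) Real.pi, ∀ ψ ∈ Set.Icc (0 : ℝ) Real.pi,
      f (Real.cos φ) (Real.cos ψ) =
        ∑' i : ℕ × ℕ, a i * Real.cos (i.1 * φ) * Real.cos (i.2 * ψ)) :
    IsSPDKernelT (fun u v : SphereR2 × SphereR2 =>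
      ((f (@inner ℝ _ _ u.1.1 v.1.1) (@inner ℝ _ _ u.2.1 v.2.1) : ℝ) : ℂ)) ↔
      MeetsAllProgressions {v : ℤ × ℤ | 0 < a (v.1.natAbs, v.2.natAbs)} := by
  constructor
  · rintro ⟨-, hs⟩ N M x y hN hM hx hy
    by_contra! hcon
    lift N to ℕ using hN.le
    lift M to ℕ using hM.le
    have hN' : 0 < N := by exact_mod_cast hN
    have hM' : 0 < M := by exact_mod_cast hM
    let e : Fin (N * M) ≃ Fin N × Fin M := finProdFinEquiv.symm
    let φ : Fin (N * M) → ℝ := fun i => 2 * Real.pi * (e i).1 / N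
    let ψ : Fin (N * M) → ℝ := fun i => 2 * Real.pi * (e i).2 / M
    let c : Fin (N * M) → ℂ := fun i =>
      Complex.exp (φ i * Complex.I) ^ (-x) * Complex.exp (ψ i * Complex.I) ^ (-y)
    have h := hs (N * M) (fun i => (pt (φ i), pt (ψ i))) (by
      intro i j hij
      simp only [Prod.mk.injEq, pt_eq_iff] at hij
      exact e.injective (Prod.ext (root_inj N _ _ hij.1) (root_inj M _ _ hij.2))) c
    simp only [pt_inner] at h
    rw [sum_zero_iff f a ha0 haS hexp φ ψ c] at h
    have hc : c = 0 := by
      refine h fun p q hpq => ?_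
      have key : FF φ ψ c p q =
          (∑ j : Fin N, Complex.exp ((2 * Real.pi * j / N : ℝ) * Complex.I) ^ (p - x)) *
          (∑ j : Fin M, Complex.exp ((2 * Real.pi * j / M : ℝ) * Complex.I) ^ (q - y)) := by
        rw [Finset.sum_mul_sum, ← Fintype.sum_prod_type', ← e.sum_comp, FF]
        refine Finset.sum_congr rfl fun i _ => ?_
        simp only [c, φ, ψ]
        rw [sub_eq_add_neg, sub_eq_add_neg, zpow_add₀ (Complex.exp_ne_zero _),
          zpow_add₀ (Complex.exp_ne_zero _)]
        ring
      rw [key]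
      by_cases h1 : (N : ℤ) ∣ p - x
      · have h2 : ¬ (M : ℤ) ∣ q - y := by
          rintro ⟨l, hl⟩
          obtain ⟨j, hj⟩ := h1
          exact hcon (p, q) hpq ⟨j, by simp only; linarith⟩ l (by simp only; linarith)
        rw [root_sum M hM' _ h2, mul_zero]
      · rw [root_sum N hN' _ h1, zero_mul]
    have := congrFun hc ⟨0, Nat.mul_pos hN' hM'⟩
    simp [c, zpow_ne_zero, Complex.exp_ne_zero] at this
  · intro hA
    refine ⟨hPD, ?_⟩
    intro L x hx c h
    choose φ hφ using fun i => pt_surj (x i).1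
    choose ψ hψ using fun i => pt_surj (x i).2
    by_contra hc
    simp only [← hφ, ← hψ, pt_inner] at h
    rw [sum_zero_iff f a ha0 haS hexp φ ψ c] at h
    obtain ⟨N, n, k, hN, hne⟩ := exists_prog L (fun i => Complex.exp (φ i * Complex.I))
      (fun i => Complex.exp (ψ i * Complex.I)) (fun i => Complex.exp_ne_zero _)
      (fun i => Complex.exp_ne_zero _) (by
        intro i j hij
        simp only [Prod.mk.injEq, ← pt_eq_iff, hφ, hψ] at hij
        exact hx (Prod.ext hij.1 hij.2)) c hc
    obtain ⟨⟨p, q⟩, hv, ⟨j, hj⟩, l, hl⟩ := hA N N (n % N + N) (k % N + N) hN hN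
      (by have := Int.emod_nonneg n hN.ne'; omega) (by have := Int.emod_nonneg k hN.ne'; omega)
    apply hne (j + 1 - n / N) (l + 1 - k / N)
    have h3 := h p q hv
    have e1 : N * (j + 1 - n / N) + n = p := by
      have := Int.emod_add_mul_ediv n N
      simp only at hj
      linarith
    have e2 : N * (l + 1 - k / N) + k = q := by
      have := Int.emod_add_mul_ediv k N
      simp only at hl
      linarith
    rw [e1, e2]
    exact h3

end
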